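/- For every positive integer n, the double inequality √((n + 1/2)/(2π)) < Ω_{n−1}/Ω_n ≤ √((n + π/2 − 1)/(2π)) holds, where Ω_n = π^{n/2}/Γ(1 + n/2) is the volume of the unit ball in ℝ^n, with equality on the right when n = 1. -/

import Mathlib

open Real

/-- `Ω n = π^{n/2}/Γ(1 + n/2)`, the volume of the unit ball in `ℝⁿ`. -/
noncomputable def unitBallVol (n : ℕ) : ℝ :=
  π ^ ((n : ℝ) / 2) / Real.Gamma (1 + (n : ℝ) / 2)

lemma Gamma_add_half_sq_le {x : ℝ} (hx : 0 < x) :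
    Real.Gamma (x + 1 / 2) ^ 2 ≤ Real.Gamma x * Real.Gamma (x + 1) := by
  have h := Real.Gamma_mul_add_mul_le_rpow_Gamma_mul_rpow_Gamma hx (by linarith : 0 < x + 1)
    (by norm_num : (0 : ℝ) < 1 / 2) (by norm_num : (0 : ℝ) < 1 / 2) (by norm_num)
  have h0 := Real.Gamma_pos_of_pos hx
  have h1 := Real.Gamma_pos_of_pos (by linarith : 0 < x + 1)
  rw [show 1 / 2 * x + 1 / 2 * (x + 1) = x + 1 / 2 by ring, ← Real.sqrt_eq_rpow,
    ← Real.sqrt_eq_rpow, ← Real.sqrt_mul h0.le] at h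
  exact (Real.le_sqrt' (Real.Gamma_pos_of_pos (by linarith))).1 h

/-- The normalized squared Gamma quotient `2 (Γ(x/2 + 1) / Γ(x/2 + 1/2))²`; at `x = n` it is
`2π (Ω_{n-1}/Ω_n)²`. -/
noncomputable def gammaQuotSq (x : ℝ) : ℝ :=
  2 * (Real.Gamma (x / 2 + 1) / Real.Gamma (x / 2 + 1 / 2)) ^ 2

lemma gammaQuotSq_pos {x : ℝ} (hx : 0 < x) : 0 < gammaQuotSq x := by
  have h0 := Real.Gamma_pos_of_pos (by linarith : 0 < x / 2 + 1)
  have h1 := Real.Gamma_pos_of_pos (by linarith : 0 < x / 2 + 1 / 2)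
  unfold gammaQuotSq
  positivity

lemma gammaQuotSq_mul_add_one {x : ℝ} (hx : 0 < x) :
    gammaQuotSq x * gammaQuotSq (x + 1) = (x + 1) ^ 2 := by
  have h0 := Real.Gamma_pos_of_pos (by linarith : 0 < x / 2 + 1)
  have h1 := Real.Gamma_pos_of_pos (by linarith : 0 < x / 2 + 1 / 2)
  unfold gammaQuotSq
  rw [show (x + 1) / 2 + 1 = (x / 2 + 1 / 2) + 1 by ring,
    show (x + 1) / 2 + 1 / 2 = x / 2 + 1 by ring,
    Real.Gamma_add_one (by linarith : x / 2 + 1 / 2 ≠ 0)]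
  field_simp

lemma gammaQuotSq_add_two {x : ℝ} (hx : 0 < x) :
    gammaQuotSq (x + 2) * (x + 1) ^ 2 = gammaQuotSq x * (x + 2) ^ 2 := by
  have h0 := gammaQuotSq_mul_add_one hx
  have h1 := gammaQuotSq_mul_add_one (by linarith : 0 < x + 1)
  rw [show x + 1 + 1 = x + 2 by ring] at h1
  rw [← h0, ← h1]
  ring

lemma le_gammaQuotSq {x : ℝ} (hx : 0 < x) : x ≤ gammaQuotSq x := by
  have h := Gamma_add_half_sq_le (by linarith : 0 < x / 2)
  have h1 := Real.Gamma_pos_of_pos (by linarith : 0 < x / 2 + 1 / 2)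
  rw [Real.Gamma_add_one (by linarith : x / 2 ≠ 0)] at h
  unfold gammaQuotSq
  rw [Real.Gamma_add_one (by linarith : x / 2 ≠ 0), div_pow, ← mul_div_assoc,
    le_div_iff₀ (by positivity)]
  nlinarith [mul_le_mul_of_nonneg_left h hx.le]

lemma gammaQuotSq_div_lt {x : ℝ} (hx : 0 < x) :
    gammaQuotSq (x + 2) / (x + 2 + 1 / 2 + 1 / (8 * (x + 2 + 1))) <
      gammaQuotSq x / (x + 1 / 2 + 1 / (8 * (x + 1))) := by
  have hq := gammaQuotSq_pos hx
  have h2 : gammaQuotSq (x + 2) = gammaQuotSq x * (x + 2) ^ 2 / (x + 1) ^ 2 := by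
    rw [eq_div_iff (by positivity), gammaQuotSq_add_two hx]
  rw [h2, mul_div_assoc, mul_div_assoc, div_eq_mul_inv (gammaQuotSq x)]
  refine mul_lt_mul_of_pos_left ?_ hq
  rw [div_div, ← one_div, div_lt_div_iff₀ (by positivity) (by positivity), ← sub_pos]
  have : 1 * ((x + 1) ^ 2 * (x + 2 + 1 / 2 + 1 / (8 * (x + 2 + 1)))) -
      (x + 2) ^ 2 * (x + 1 / 2 + 1 / (8 * (x + 1))) =
      (3 * x + 1) / (8 * (x + 3) * (x + 1)) := by
    rw [show x + 2 + 1 = x + 3 by ring]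
    field_simp
    ring
  rw [this]
  positivity

lemma lt_gammaQuotSq {x : ℝ} (hx : 0 < x) :
    x + 1 / 2 + 1 / (8 * (x + 1)) < gammaQuotSq x := by
  let f : ℝ → ℝ := fun y ↦ gammaQuotSq y / (y + 1 / 2 + 1 / (8 * (y + 1)))
  have anti (y : ℝ) (hy : 0 < y) (k : ℕ) : f (y + 2 * k) ≤ f y := by
    induction k with
    | zero => simp
    | succ k ih =>
      have := gammaQuotSq_div_lt (by positivity : 0 < y + 2 * k)
      push_cast
      rw [show y + 2 * ((k : ℝ) + 1) = y + 2 * k + 2 by ring]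
      exact this.le.trans ih
  have one_le (y : ℝ) (hy : 0 < y) : 1 ≤ f y := by
    have hlow (k : ℕ) : 1 - 1 / ((k : ℝ) + 1) ≤ f y := by
      refine le_trans ?_ (anti y hy k)
      have hz : 0 < y + 2 * k := by positivity
      have hkz : (k : ℝ) ≤ y + 2 * k := by
        have : (0 : ℝ) ≤ k := by positivity
        linarith
      generalize y + 2 * (k : ℝ) = z at hz hkz
      have hb : 1 / (8 * (z + 1)) ≤ 1 / 2 :=
        one_div_le_one_div_of_le (by norm_num) (by linarith)
      calc 1 - 1 / ((k : ℝ) + 1) ≤ 1 - 1 / (z + 1) := by gcongr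
        _ = z / (z + 1) := by field_simp; ring
        _ ≤ gammaQuotSq z / (z + 1 / 2 + 1 / (8 * (z + 1))) := by
          apply div_le_div₀ (gammaQuotSq_pos hz).le (le_gammaQuotSq hz) (by positivity)
          linarith
    have ht := (tendsto_one_div_add_atTop_nhds_zero_nat (𝕜 := ℝ)).const_sub 1
    rw [sub_zero] at ht
    exact le_of_tendsto' ht hlow
  have h := (one_le (x + 2) (by linarith)).trans_lt (gammaQuotSq_div_lt hx)
  exact (one_lt_div (by positivity)).1 h

lemma gammaQuotSq_add_one_lt {x : ℝ} (hx : 0 < x) :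
    gammaQuotSq (x + 1) < gammaQuotSq x + 1 := by
  have hlt := lt_gammaQuotSq hx
  have hq := gammaQuotSq_pos hx
  have hc : 1 / (8 * (x + 1)) * (x + 1) = 1 / 8 := by field_simp
  have hc0 : 0 < 1 / (8 * (x + 1)) := by positivity
  generalize 1 / (8 * (x + 1)) = c at hlt hc hc0
  have hsq : (x + 1) ^ 2 < gammaQuotSq x * (gammaQuotSq x + 1) := by
    calc (x + 1) ^ 2 < (x + 1 / 2 + c) * (x + 1 / 2 + c + 1) := by nlinarith
      _ ≤ gammaQuotSq x * (gammaQuotSq x + 1) := by gcongr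
  rw [← gammaQuotSq_mul_add_one hx] at hsq
  exact lt_of_mul_lt_mul_left hsq hq.le

lemma gammaQuotSq_one : gammaQuotSq 1 = π / 2 := by
  unfold gammaQuotSq
  rw [show (1 : ℝ) / 2 + 1 / 2 = 1 by norm_num, Real.Gamma_one,
    Real.Gamma_add_one (by norm_num), Real.Gamma_one_half_eq, div_one, mul_pow,
    Real.sq_sqrt pi_pos.le]
  ring

lemma gammaQuotSq_natCast_le (n : ℕ) (hn : 0 < n) : gammaQuotSq n ≤ n + π / 2 - 1 := by
  induction n, hn using Nat.le_induction with
  | base => simp [gammaQuotSq_one]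
  | succ n hn ih =>
    have := gammaQuotSq_add_one_lt (by exact_mod_cast hn : (0 : ℝ) < n)
    push_cast
    linarith

lemma unitBallVol_ratio_eq_sqrt (n : ℕ) (hn : 0 < n) :
    unitBallVol (n - 1) / unitBallVol n = Real.sqrt (gammaQuotSq n / (2 * π)) := by
  have hn' : (0 : ℝ) < n := by exact_mod_cast hn
  have h0 := Real.Gamma_pos_of_pos (by linarith : 0 < (n : ℝ) / 2 + 1)
  have h1 := Real.Gamma_pos_of_pos (by linarith : 0 < (n : ℝ) / 2 + 1 / 2)
  have hp : π ^ ((n : ℝ) / 2) = π ^ (((n : ℝ) - 1) / 2) * √π := by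
    rw [Real.sqrt_eq_rpow, ← Real.rpow_add pi_pos]
    ring_nf
  have hpos : 0 < π ^ (((n : ℝ) - 1) / 2) := Real.rpow_pos_of_pos pi_pos _
  have hs : √π ≠ 0 := (Real.sqrt_pos.2 pi_pos).ne'
  unfold unitBallVol gammaQuotSq
  rw [mul_div_mul_left _ _ two_ne_zero, Real.sqrt_div (by positivity),
    Real.sqrt_sq (by positivity), Nat.cast_sub hn, hp, Nat.cast_one,
    show 1 + ((n : ℝ) - 1) / 2 = n / 2 + 1 / 2 by ring, add_comm 1 ((n : ℝ) / 2)]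
  field_simp

/-- For every positive integer `n`,
`√((n + 1/2)/(2π)) < Ω_{n−1}/Ω_n ≤ √((n + π/2 − 1)/(2π))`,
with equality on the right when `n = 1`. -/
theorem unit_ball_vol_ratio_bounds :
    (∀ n : ℕ, 0 < n →
      Real.sqrt ((n + 1 / 2) / (2 * π)) < unitBallVol (n - 1) / unitBallVol n ∧
        unitBallVol (n - 1) / unitBallVol n ≤
          Real.sqrt ((n + π / 2 - 1) / (2 * π))) ∧
    unitBallVol 0 / unitBallVol 1 = Real.sqrt ((1 + π / 2 - 1) / (2 * π)) := by
  refine ⟨fun n hn ↦ ?_, ?_⟩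
  · have hn' : (0 : ℝ) < n := by exact_mod_cast hn
    rw [unitBallVol_ratio_eq_sqrt n hn]
    constructor
    · apply Real.sqrt_lt_sqrt (by positivity)
      gcongr
      have := lt_gammaQuotSq hn'
      have : 0 < 1 / (8 * ((n : ℝ) + 1)) := by positivity
      linarith
    · gcongr
      exact gammaQuotSq_natCast_le n hn
  · have h := unitBallVol_ratio_eq_sqrt 1 one_pos
    rw [Nat.sub_self, Nat.cast_one, gammaQuotSq_one] at h
    rw [h, add_sub_cancel_left]
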